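/- Let A be a C*-algebra, let (bₙ) be a nondecreasing sequence of positive elements of A converging in norm to b ∈ A, and let a ∈ A be positive with a ≾ b. Then for every ε > 0 there exists n such that (a − ε)₊ ≾ bₙ. -/

import Mathlib

/-- Cuntz subequivalence in a (non-unital) C*-algebra. -/
def CuntzLE {A : Type*} [NonUnitalCStarAlgebra A] (a b : A) : Prop :=
  ∀ ε > 0, ∃ r : A, ‖r * b * star r - a‖ < ε

/-- Cuntz equivalence. -/
def CuntzEquiv {A : Type*} [NonUnitalCStarAlgebra A] (a b : A) : Prop :=
  CuntzLE a b ∧ CuntzLE b a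

/-- The ε-cut-down `(a - ε)₊` of an element, via non-unital continuous functional calculus. -/
noncomputable def cutDown {A : Type*} [NonUnitalCStarAlgebra A] (a : A) (ε : ℝ) : A :=
  cfcₙ (fun t : ℝ => max (t - ε) 0) a

theorem aux_le_approx {A : Type*} [NonUnitalCStarAlgebra A] [PartialOrder A]
    [StarOrderedRing A] (x y : A) (hx : 0 ≤ x) (hxy : x ≤ y) (η : ℝ) (hη : 0 < η) :
    ∃ u k q : A, u * star u = x ∧ ‖u‖ ^ 2 = ‖x‖ ∧ k * y * star k = q * star q ∧
      ‖u * q - u‖ ^ 2 ≤ η := by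
  have hy : 0 ≤ y := hx.trans hxy
  have hys : IsSelfAdjoint y := IsSelfAdjoint.of_nonneg hy
  obtain ⟨v, hv⟩ := CStarAlgebra.nonneg_iff_eq_star_mul_self.mp hx
  obtain ⟨s, hs⟩ := CStarAlgebra.nonneg_iff_eq_star_mul_self.mp (sub_nonneg.mpr hxy)
  have hne : ∀ t : ℝ, |t| + η ≠ 0 := fun t => by positivity
  have hqc : Continuous (fun t : ℝ => t / (|t| + η)) := by
    fun_prop (disch := exact hne _)
  have hkc : Continuous (fun t : ℝ => √|t| / (|t| + η)) := by
    refine Continuous.div ?_ (by fun_prop) hne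
    exact Real.continuous_sqrt.comp continuous_abs
  set q : A := cfcₙ (fun t : ℝ => t / (|t| + η)) y with hq
  set k : A := cfcₙ (fun t : ℝ => √|t| / (|t| + η)) y with hk
  have hqs : star q = q := (cfcₙ_predicate (R := ℝ) (p := IsSelfAdjoint) _ y : IsSelfAdjoint q)
  have hks : star k = k := (cfcₙ_predicate (R := ℝ) (p := IsSelfAdjoint) _ y : IsSelfAdjoint k)
  set u : A := CFC.sqrt x with hu
  have hus : star u = u := (IsSelfAdjoint.of_nonneg (CFC.sqrt_nonneg x))
  have huu : u * u = x := CFC.sqrt_mul_sqrt_self x hx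
  have hid : cfcₙ (fun t : ℝ => t) y = y := cfcₙ_id' ℝ y
  have hqc' := hqc.continuousOn (s := quasispectrum ℝ y)
  have hkc' := hkc.continuousOn (s := quasispectrum ℝ y)
  have h1 : k * y * star k = q * star q := by
    rw [hks, hqs]
    have hky : k * y * k = k * cfcₙ (fun t : ℝ => t) y * k := by rw [hid]
    rw [hky, hk, hq, ← cfcₙ_mul _ _ y hkc' (by simp) (by fun_prop) (by simp),
      ← cfcₙ_mul _ _ y (by fun_prop) (by simp) hkc' (by simp),
      ← cfcₙ_mul _ _ y hqc' (by simp) hqc' (by simp)]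
    refine cfcₙ_congr fun t ht => ?_
    have ht0 : 0 ≤ t := quasispectrum_nonneg_of_nonneg y hy t ht
    have hss := Real.mul_self_sqrt ht0
    simp only [abs_of_nonneg ht0]
    have e0 : ∀ w : ℝ, √t * w * t * (√t * w) = t * w * (t * w) := fun w => by
      linear_combination (w * w * t) * hss
    simpa only [div_eq_mul_inv] using e0 (t + η)⁻¹
  have h2 : y - q * y - y * q + q * y * q
      = cfcₙ (fun t : ℝ => t - t / (|t| + η) * t - t * (t / (|t| + η))
          + t / (|t| + η) * t * (t / (|t| + η))) y := by
    have hi : ContinuousOn (fun t : ℝ => t) (quasispectrum ℝ y) := continuousOn_id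
    rw [cfcₙ_add _ _ y (by fun_prop) (by simp) (by fun_prop) (by simp),
      cfcₙ_sub _ _ y (by fun_prop) (by simp) (by fun_prop) (by simp),
      cfcₙ_sub _ _ y (by fun_prop) (by simp) (by fun_prop) (by simp),
      cfcₙ_mul (fun t : ℝ => t / (|t| + η) * t) (fun t : ℝ => t / (|t| + η)) y
        (by fun_prop) (by simp) hqc' (by simp),
      cfcₙ_mul (fun t : ℝ => t / (|t| + η)) (fun t : ℝ => t) y hqc' (by simp) hi (by simp),
      cfcₙ_mul (fun t : ℝ => t) (fun t : ℝ => t / (|t| + η)) y hi (by simp) hqc' (by simp), hid]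
  have h3 : ‖y - q * y - y * q + q * y * q‖ ≤ η := by
    rw [h2]
    refine norm_cfcₙ_le fun t ht => ?_
    have ht0 : 0 ≤ t := quasispectrum_nonneg_of_nonneg y hy t ht
    simp only [abs_of_nonneg ht0]
    have hp : 0 < t + η := by positivity
    have : t - t / (t + η) * t - t * (t / (t + η)) + t / (t + η) * t * (t / (t + η))
        = t * η ^ 2 / (t + η) ^ 2 := by
      field_simp
      ring
    rw [this, Real.norm_of_nonneg (by positivity), div_le_iff₀ (by positivity)]
    nlinarith [mul_nonneg ht0 ht0, mul_pos hη hη, mul_nonneg ht0 hη.le,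
      mul_nonneg hη.le (mul_nonneg ht0 ht0), mul_nonneg ht0 (mul_pos hη hη).le, pow_pos hη 3]
  have e1 : star (u * q - u) * (u * q - u) = x - q * x - x * q + q * x * q := by
    simp only [star_sub, star_mul, hqs, hus, ← huu]
    noncomm_ring
  have e2 : star (s * q - s) * (s * q - s)
      = (y - q * y - y * q + q * y * q) - (x - q * x - x * q + q * x * q) := by
    have : y = star s * s + x := by rw [← hs]; abel
    rw [this]
    simp only [star_sub, star_mul, hqs]
    noncomm_ring
  refine ⟨u, k, q, by rw [hus, huu], ?_, h1, ?_⟩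
  · rw [← huu, pow_two, ← CStarRing.norm_star_mul_self, hus]
  · rw [pow_two, ← CStarRing.norm_star_mul_self]
    refine le_trans (CStarAlgebra.norm_le_norm_of_nonneg_of_le (star_mul_self_nonneg _) ?_) h3
    rw [e1, ← sub_nonneg, ← e2]
    exact star_mul_self_nonneg _

theorem aux_cuntzLE_of_le {A : Type*} [NonUnitalCStarAlgebra A] [PartialOrder A]
    [StarOrderedRing A] (x y : A) (hx : 0 ≤ x) (hxy : x ≤ y) : CuntzLE x y := by
  intro ε hε
  set M : ℝ := √‖x‖ with hM
  have hM0 : 0 ≤ M := Real.sqrt_nonneg _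
  set d : ℝ := min 1 (ε / (2 * (2 * M + 1))) with hd
  have hd0 : 0 < d := by positivity
  have hd1 : d ≤ 1 := min_le_left _ _
  have hd2 : d * (2 * (2 * M + 1)) ≤ ε := by
    rw [← le_div_iff₀ (by positivity)]; exact min_le_right _ _
  obtain ⟨u, k, q, huu, hun, hk, hb⟩ := aux_le_approx x y hx hxy (d ^ 2) (by positivity)
  have hb' : ‖u * q - u‖ ≤ d := (sq_le_sq₀ (norm_nonneg _) hd0.le).mp hb
  have hu' : ‖u‖ = M := by rw [hM, ← hun, Real.sqrt_sq (norm_nonneg _)]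
  refine ⟨u * k, ?_⟩
  have : u * k * y * star (u * k) - x
      = (u * q - u) * star (u * q - u) + (u * q - u) * star u + u * star (u * q - u) := by
    calc u * k * y * star (u * k) - x = u * (k * y * star k) * star u - u * star u := by
          rw [huu, star_mul]; noncomm_ring
      _ = _ := by
          rw [hk]; simp only [star_sub, star_mul]; noncomm_ring
  rw [this]
  have n1 := norm_add₃_le (a := (u * q - u) * star (u * q - u)) (b := (u * q - u) * star u)
    (c := u * star (u * q - u))
  have n2 := norm_mul_le (u * q - u) (star (u * q - u))
  have n3 := norm_mul_le (u * q - u) (star u)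
  have n4 := norm_mul_le u (star (u * q - u))
  rw [norm_star] at n2 n3 n4
  rw [hu'] at n3 n4
  have := norm_nonneg (u * q - u)
  nlinarith

theorem aux_rordam {A : Type*} [NonUnitalCStarAlgebra A] [PartialOrder A]
    [StarOrderedRing A] (a c : A) (ha : 0 ≤ a) (hc : 0 ≤ c) (ε : ℝ) (h : ‖a - c‖ < ε) :
    ∃ e : A, cutDown a ε ≤ e * c * star e := by
  set δ := ‖a - c‖ with hδ
  have hδ0 : 0 ≤ δ := norm_nonneg _
  have hε : 0 < ε := hδ0.trans_lt h
  have hne : ∀ t : ℝ, max (t - δ) (ε - δ) ≠ 0 := fun t =>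
    (lt_max_of_lt_right (sub_pos.mpr h)).ne'
  have hfc : Continuous (fun t : ℝ => √(max (t - ε) 0 / max (t - δ) (ε - δ))) := by
    refine Real.continuous_sqrt.comp ?_
    fun_prop (disch := exact hne _)
  have hf0 : (fun t : ℝ => √(max (t - ε) 0 / max (t - δ) (ε - δ))) 0 = 0 := by
    simp [hε.le]
  set f := (fun t : ℝ => √(max (t - ε) 0 / max (t - δ) (ε - δ))) with hf
  have hfc' := hfc.continuousOn (s := quasispectrum ℝ a)
  set e := cfcₙ f a with he
  have has : IsSelfAdjoint a := IsSelfAdjoint.of_nonneg ha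
  have hid : cfcₙ (fun t : ℝ => t) a = a := cfcₙ_id' ℝ a
  have hes : star e = e := (cfcₙ_predicate (R := ℝ) (p := IsSelfAdjoint) _ a : IsSelfAdjoint e)
  have hi : ContinuousOn (fun t : ℝ => t) (quasispectrum ℝ a) := continuousOn_id
  have key : cutDown a ε = e * a * e - δ • (e * e) := by
    have hea : e * a * e = e * cfcₙ (fun t : ℝ => t) a * e := by rw [hid]
    rw [hea, cutDown, he, ← cfcₙ_mul _ _ a hfc' hf0 hi rfl,
      ← cfcₙ_mul _ _ a (by fun_prop) (by simp) hfc' hf0,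
      ← cfcₙ_mul _ _ a hfc' hf0 hfc' hf0,
      ← cfcₙ_smul δ _ a (by fun_prop) (by simp [hf0]),
      ← cfcₙ_sub _ _ a (by fun_prop) (by simp)
        (by fun_prop) (by simp [hf0])]
    refine cfcₙ_congr fun t ht => ?_
    have hm : 0 < max (t - δ) (ε - δ) := lt_max_of_lt_right (sub_pos.mpr h)
    have hff : f t * f t = max (t - ε) 0 / max (t - δ) (ε - δ) :=
      Real.mul_self_sqrt (by positivity)
    simp only [smul_eq_mul]
    have : f t * t * f t - δ * (f t * f t) = (f t * f t) * (t - δ) := by ring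
    rw [this, hff]
    rcases le_total t ε with h' | h'
    · rw [max_eq_right (by linarith : t - ε ≤ 0)]; simp
    · rw [max_eq_left (by linarith : ε - δ ≤ t - δ), div_mul_cancel₀]
      linarith
  have hsa : IsSelfAdjoint (a - c) := has.sub (IsSelfAdjoint.of_nonneg hc)
  have hle := CStarAlgebra.star_left_conjugate_le_norm_smul (a := e) (b := a - c) hsa
  rw [hes, ← hδ] at hle
  refine ⟨e, ?_⟩
  rw [key, hes, sub_le_iff_le_add, ← sub_le_iff_le_add']
  refine le_trans (le_of_eq ?_) hle
  noncomm_ring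

/-- If `a ≾ b` and `b` is the norm limit of a nondecreasing sequence of positive elements
`bₙ`, then every cut-down `(a - ε)₊` is dominated by some `bₙ`. -/
theorem cutDown_cuntzLE_of_tendsto {A : Type*} [NonUnitalCStarAlgebra A] [PartialOrder A]
    [StarOrderedRing A] (bseq : ℕ → A) (hpos : ∀ n, 0 ≤ bseq n)
    (hmono : ∀ n, bseq n ≤ bseq (n + 1)) (b : A)
    (hlim : Filter.Tendsto bseq Filter.atTop (nhds b)) (a : A) (ha : 0 ≤ a)
    (hab : CuntzLE a b) :
    ∀ ε > 0, ∃ n, CuntzLE (cutDown a ε) (bseq n) := by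
  intro ε hε
  obtain ⟨r, hr⟩ := hab ε hε
  have hl : Filter.Tendsto (fun n => ‖r * bseq n * star r - a‖) Filter.atTop
      (nhds ‖r * b * star r - a‖) :=
    (((hlim.const_mul r).mul_const (star r)).sub_const a).norm
  obtain ⟨n, hn⟩ := (hl.eventually_lt_const hr).exists
  rw [norm_sub_rev] at hn
  obtain ⟨e, he⟩ := aux_rordam a (r * bseq n * star r) ha
    (star_right_conjugate_nonneg (hpos n) r) ε hn
  have h0 : 0 ≤ cutDown a ε := cfcₙ_nonneg fun t _ => le_max_right _ _
  refine ⟨n, fun η hη => ?_⟩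
  obtain ⟨s, hs⟩ := aux_cuntzLE_of_le _ _ h0 he η hη
  refine ⟨s * e * r, ?_⟩
  simpa only [star_mul, mul_assoc] using hs
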